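/- arXiv:1703.01403 — 2 statements merged into one kernel-verified Lean document; each statement's English description precedes it below -/
import Mathlib

section
/- Let g : ℂ → ℂ be entire, not identically zero, and suppose there exist constants C > 0 and τ ≥ 0 such that |g(k)| ≤ C·exp(τ·|Im k|) for all k ∈ ℂ. For r > 0 let n(r) denote the number of zeros of g in the closed disk {k : |k| ≤ r} (a finite number, counted without multiplicity). Then liminf_{r→∞} n(r)/r ≤ 2τ/π. -/
open Complex

lemma zc_avg_im (R : ℝ) (hR : 0 < R) :
    Real.circleAverage (fun z : ℂ => |z.im|) 0 R = 2 * R / Real.pi := by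
  have h1 : ∀ θ : ℝ, |(circleMap 0 R θ).im| = R * |Real.sin θ| := by
    intro θ
    rw [circleMap_zero_im, abs_mul, abs_of_pos hR]
  have hc : Continuous fun θ : ℝ => |Real.sin θ| := Real.continuous_sin.abs
  have e1 : ∫ θ in (0:ℝ)..Real.pi, |Real.sin θ| = 2 := by
    have e0 : ∫ θ in (0:ℝ)..Real.pi, Real.sin θ = 2 := by
      rw [integral_sin]; norm_num
    rw [← e0]
    apply intervalIntegral.integral_congr
    intro θ hθ
    rw [Set.uIcc_of_le Real.pi_pos.le] at hθ
    exact abs_of_nonneg (Real.sin_nonneg_of_mem_Icc hθ)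
  have e2 : ∫ θ in Real.pi..(2 * Real.pi), |Real.sin θ| = 2 := by
    have := intervalIntegral.integral_comp_add_right (a := 0) (b := Real.pi)
      (fun θ : ℝ => |Real.sin θ|) Real.pi
    simp only [Real.sin_add_pi, abs_neg, zero_add] at this
    rw [two_mul, ← this, e1]
  have e3 : ∫ θ in (0:ℝ)..(2 * Real.pi), |Real.sin θ| = 4 := by
    rw [← intervalIntegral.integral_add_adjacent_intervals
      (hc.intervalIntegrable 0 Real.pi) (hc.intervalIntegrable _ _), e1, e2]
    norm_num
  rw [Real.circleAverage_def]
  simp only [h1]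
  rw [intervalIntegral.integral_const_mul, e3, smul_eq_mul]
  have := Real.pi_pos
  field_simp
  norm_num

lemma zc_integrable (a r0 R : ℝ) (h0 : 1 ≤ r0) (hR : r0 ≤ R) :
    IntervalIntegrable ((Set.Ici a).indicator fun t : ℝ => t⁻¹) MeasureTheory.volume r0 R := by
  rw [intervalIntegrable_iff_integrableOn_Ioc_of_le hR]
  apply MeasureTheory.IntegrableOn.indicator _ measurableSet_Ici
  rw [← intervalIntegrable_iff_integrableOn_Ioc_of_le hR]
  apply intervalIntegral.intervalIntegrable_inv
  · intro x hx
    rw [Set.uIcc_of_le hR] at hx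
    have := hx.1
    intro h
    linarith
  · exact continuousOn_id

lemma zc_int_le (a r0 R : ℝ) (ha : 0 ≤ a) (haR : a ≤ R) (h0 : 1 ≤ r0) (hR : r0 ≤ R) :
    ∫ t in r0..R, (Set.Ici a).indicator (fun t : ℝ => t⁻¹) t ≤ Real.log R - Real.log a := by
  have hm : max r0 a ≤ R := max_le hR haR
  have hm1 : 1 ≤ max r0 a := le_max_of_le_left h0
  have : ∫ t in r0..R, (Set.Ici a).indicator (fun t : ℝ => t⁻¹) t
      = ∫ t in (max r0 a)..R, t⁻¹ := by
    rw [intervalIntegral.integral_of_le hR, intervalIntegral.integral_of_le hm,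
      MeasureTheory.setIntegral_indicator measurableSet_Ici]
    have e : Set.Ioc (max r0 a) R = Set.Ioc r0 R ∩ Set.Ioi a := by
      ext x; simp only [Set.mem_Ioc, Set.mem_inter_iff, Set.mem_Ioi, max_lt_iff]; tauto
    rw [e]
    apply MeasureTheory.setIntegral_congr_set
    exact (Filter.EventuallyEq.refl _ _).inter MeasureTheory.Ioi_ae_eq_Ici.symm
  rw [this, integral_inv_of_pos (by linarith) (by linarith),
    Real.log_div (by linarith) (by linarith)]
  have : Real.log a ≤ Real.log (max r0 a) := by
    rcases ha.eq_or_lt with h | h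
    · rw [← h, Real.log_zero]; exact Real.log_nonneg (by rw [h]; exact hm1)
    · exact Real.log_le_log h (le_max_right _ _)
  linarith

lemma zc_main (g : ℂ → ℂ) (hg : Differentiable ℂ g) (hg0 : ∃ k : ℂ, g k ≠ 0)
    (C τ : ℝ) (hC : 1 ≤ C) (hτ : 0 ≤ τ)
    (hbound : ∀ k : ℂ, ‖g k‖ ≤ C * Real.exp (τ * |k.im|))
    (c r0 R : ℝ) (h0 : 1 ≤ r0) (hR : r0 ≤ R)
    (hn : ∀ r, r0 ≤ r → c * r ≤ ({k : ℂ | ‖k‖ ≤ r ∧ g k = 0}.ncard : ℝ)) :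
    c * (R - r0) ≤ Real.log C + τ * (2 * R / Real.pi)
      - Real.log ‖meromorphicTrailingCoeffAt g 0‖ := by
  have hRpos : 0 < R := by linarith
  have han : AnalyticOnNhd ℂ g (Metric.closedBall 0 |R|) := fun x _ => hg.analyticAt x
  have hJ := han.meromorphicOn.circleAverage_log_norm hRpos.ne'
  set D := MeromorphicOn.divisor g (Metric.closedBall 0 |R|) with hD
  have hfin : (D : ℂ → ℤ).HasFiniteSupport := D.finiteSupport (isCompact_closedBall 0 |R|)
  rw [← countingFunction_finsum_eq_finsum_add hRpos.ne' hfin] at hJ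
  -- upper bound
  have hup : Real.circleAverage (fun z => Real.log ‖g z‖) 0 R
      ≤ Real.log C + τ * (2 * R / Real.pi) := by
    have hcont : Continuous fun z : ℂ => |z.im| := Complex.continuous_im.abs
    have : Real.circleAverage (fun z : ℂ => Real.log C + τ • |z.im|) 0 R
        = Real.log C + τ * (2 * R / Real.pi) := by
      rw [Real.circleAverage_fun_add, Real.circleAverage_const, Real.circleAverage_fun_smul,
        zc_avg_im R hRpos, smul_eq_mul]
      · exact (continuous_const.continuousOn).circleIntegrable'
      · exact ((hcont.const_smul τ).continuousOn).circleIntegrable'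
    rw [← this]
    apply Real.circleAverage_mono
    · exact (han.mono Metric.sphere_subset_closedBall).meromorphicOn.circleIntegrable_log_norm
    · exact ((continuous_const.add (hcont.const_smul τ)).continuousOn).circleIntegrable'
    · intro x _
      have hnn : 0 ≤ Real.log C + τ * |x.im| :=
        add_nonneg (Real.log_nonneg hC) (mul_nonneg hτ (abs_nonneg _))
      rw [smul_eq_mul]
      by_cases hx : g x = 0
      · simpa [hx] using hnn
      · have h := Real.log_le_log (norm_pos_iff.2 hx) (hbound x)
        rwa [Real.log_mul (by linarith) (Real.exp_ne_zero _), Real.log_exp] at h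
  -- zeros lie in the support
  have hsupp : ∀ u, ‖u‖ ≤ R → g u = 0 → D u ≠ 0 := by
    intro u hu hgu
    have hmem : u ∈ Metric.closedBall (0:ℂ) |R| := by
      simpa [abs_of_pos hRpos] using hu
    rw [hD, MeromorphicOn.AnalyticOnNhd.divisor_apply han hmem]
    have h1 : analyticOrderAt g u ≠ 0 := by
      rw [(hg.analyticAt u).analyticOrderAt_ne_zero]; exact hgu
    have h2 : analyticOrderAt g u ≠ ⊤ := by
      intro h
      rw [analyticOrderAt_eq_top] at h
      obtain ⟨k, hk⟩ := hg0
      have : g = fun _ => 0 := AnalyticOnNhd.eq_of_eventuallyEq (z₀ := u)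
        (fun x _ => hg.analyticAt x) (fun x _ => analyticAt_const) h
      exact hk (by rw [this])
    lift analyticOrderAt g u to ℕ using h2 with m
    simpa using h1
  have hDnn : ∀ u, 0 ≤ D u := fun u => MeromorphicOn.AnalyticOnNhd.divisor_nonneg han u
  set S := hfin.toFinset with hS
  have hmemS : ∀ u, u ∈ S ↔ D u ≠ 0 := by 
    intro u
    rw [hS]
    exact Set.Finite.mem_toFinset hfin
  have hSR : ∀ u ∈ S, ‖u‖ ≤ R := by
    intro u hu
    have : u ∈ Metric.closedBall (0:ℂ) |R| :=
      D.supportWithinDomain (by simpa using (hmemS u).1 hu)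
    simpa [abs_of_pos hRpos] using this
  have hsum : ∑ᶠ u, (D u : ℝ) * (Real.log R - Real.log ‖0 - u‖)
      = ∑ u ∈ S, (D u : ℝ) * (Real.log R - Real.log ‖u‖) := by
    rw [finsum_eq_sum_of_support_subset (s := S)]
    · simp
    · intro u hu
      simp only [Finset.mem_coe, hmemS]
      intro h
      simp [h] at hu
  have hlow : c * (R - r0) ≤ ∑ u ∈ S, (D u : ℝ) * (Real.log R - Real.log ‖u‖) := by
    calc c * (R - r0) = ∫ t in r0..R, c := by simp [mul_comm]
      _ ≤ ∫ t in r0..R, ∑ u ∈ S, (Set.Ici ‖u‖).indicator (fun t : ℝ => t⁻¹) t := by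
        apply intervalIntegral.integral_mono_on hR (by simp)
        · have hs := IntervalIntegrable.sum S
            (f := fun u : ℂ => (Set.Ici ‖u‖).indicator (fun t : ℝ => t⁻¹))
            (μ := MeasureTheory.volume) (a := r0) (b := R) (fun u _ => ?_)
          · have e : (fun t : ℝ => ∑ u ∈ S, (Set.Ici ‖u‖).indicator (fun t : ℝ => t⁻¹) t)
                = ∑ u ∈ S, (Set.Ici ‖u‖).indicator (fun t : ℝ => t⁻¹) := by
              funext t
              rw [Finset.sum_apply]
            rw [e]
            exact hs
          exact zc_integrable _ _ _ h0 hR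
        · intro t ht
          have htpos : 0 < t := by linarith [ht.1]
          have h1 := hn t ht.1
          classical
          have h2 : {k : ℂ | ‖k‖ ≤ t ∧ g k = 0}.ncard ≤ (S.filter fun u => ‖u‖ ≤ t).card := by
            rw [← Set.ncard_coe_finset]
            apply Set.ncard_le_ncard _ (Finset.finite_toSet _)
            intro k hk
            simp only [Finset.coe_filter, Set.mem_ofPred_eq, hmemS]
            exact ⟨hsupp k (hk.1.trans ht.2) hk.2, hk.1⟩
          have h3 : ∑ u ∈ S, (Set.Ici ‖u‖).indicator (fun t : ℝ => t⁻¹) t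
              = ((S.filter fun u => ‖u‖ ≤ t).card : ℝ) * t⁻¹ := by
            simp only [Set.indicator_apply, Set.mem_Ici]
            rw [← Finset.sum_filter, Finset.sum_const, nsmul_eq_mul]
          rw [h3, ← div_eq_mul_inv, le_div_iff₀ htpos]
          exact h1.trans (by exact_mod_cast h2)
      _ = ∑ u ∈ S, ∫ t in r0..R, (Set.Ici ‖u‖).indicator (fun t : ℝ => t⁻¹) t := by
        apply intervalIntegral.integral_finsetSum
        intro u _
        exact zc_integrable _ _ _ h0 hR
      _ ≤ _ := by
        apply Finset.sum_le_sum
        intro u hu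
        have h1 := zc_int_le ‖u‖ r0 R (norm_nonneg u) (hSR u hu) h0 hR
        have h2 : 0 ≤ Real.log R - Real.log ‖u‖ := by
          refine le_trans ?_ h1
          apply intervalIntegral.integral_nonneg hR
          intro t ht
          apply Set.indicator_nonneg
          intro x hx
          exact inv_nonneg.2 ((norm_nonneg u).trans hx)
        have h3 : (1:ℝ) ≤ D u := by
          have a := hDnn u
          have b := (hmemS u).1 hu
          have : 1 ≤ D u := by omega
          exact_mod_cast this
        nlinarith
  rw [hsum] at hJ
  linarith

/-- Lemma 3.3 (Levin): for an entire function `g ≢ 0` of exponential type with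
`|g(k)| ≤ C e^{τ |Im k|}`, the zero-counting function satisfies
`liminf_{r→∞} n(r)/r ≤ (1/2π) ∫₀^{2π} h_g(θ) dθ ≤ 2τ/π`. -/
theorem zero_counting_liminf_le
    (g : ℂ → ℂ) (hg : Differentiable ℂ g) (hg0 : ∃ k : ℂ, g k ≠ 0)
    (C τ : ℝ) (hC : 0 < C) (hτ : 0 ≤ τ)
    (hbound : ∀ k : ℂ, ‖g k‖ ≤ C * Real.exp (τ * |k.im|)) :
    Filter.liminf (fun r : ℝ =>
        ((({k : ℂ | ‖k‖ ≤ r ∧ g k = 0}.ncard : ℝ) / r : ℝ) : EReal))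
      Filter.atTop ≤ ((2 * τ / Real.pi : ℝ) : EReal) := by
  by_contra h
  rw [not_le] at h
  obtain ⟨c, hc1, hc2⟩ := EReal.lt_iff_exists_real_btwn.1 h
  have hc : 2 * τ / Real.pi < c := by exact_mod_cast hc1
  have hev := Filter.eventually_lt_of_lt_liminf hc2
  obtain ⟨r1, hr1⟩ := Filter.eventually_atTop.1 hev
  set r0 := max 1 r1 with hr0
  have h0 : 1 ≤ r0 := le_max_left _ _
  have hn : ∀ r, r0 ≤ r → c * r ≤ ({k : ℂ | ‖k‖ ≤ r ∧ g k = 0}.ncard : ℝ) := by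
    intro r hr
    have h1 := hr1 r ((le_max_right _ _).trans hr)
    have h2 : c < ({k : ℂ | ‖k‖ ≤ r ∧ g k = 0}.ncard : ℝ) / r := by exact_mod_cast h1
    exact ((lt_div_iff₀ (by linarith)).1 h2).le
  have hb : ∀ k : ℂ, ‖g k‖ ≤ max C 1 * Real.exp (τ * |k.im|) := fun k =>
    (hbound k).trans (mul_le_mul_of_nonneg_right (le_max_left _ _) (Real.exp_pos _).le)
  have key := fun R hR => zc_main g hg hg0 (max C 1) τ (le_max_right _ _) hτ hb c r0 R h0 hR hn
  set K := Real.log (max C 1) - Real.log ‖meromorphicTrailingCoeffAt g 0‖ + c * r0 with hK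
  have hd : 0 < c - 2 * τ / Real.pi := by linarith
  have key2 := key (max r0 ((K + 1) / (c - 2 * τ / Real.pi))) (le_max_left _ _)
  set R := max r0 ((K + 1) / (c - 2 * τ / Real.pi)) with hRdef
  have h3 : (K + 1) / (c - 2 * τ / Real.pi) ≤ R := le_max_right _ _
  rw [div_le_iff₀ hd] at h3
  have h4 : τ * (2 * R / Real.pi) = R * (2 * τ / Real.pi) := by ring
  rw [h4] at key2
  linarith
end

section
/- Let b ≥ 0 and let g : ℂ → ℂ be entire with |g(k)| ≤ C·exp(2b·|Im k|) for all k ∈ ℂ and some constant C > 0. For r > 0 let n(r) be the cardinality of {k ∈ ℂ : |k| ≤ r and g(k) = 0}. If there exists σ > b such that liminf_{r→∞} n(r)/r ≥ 4σ/π (in particular if n(r) ≥ (4σ/π)·r·(1 + o(1)) as r → ∞), then g is identically zero on ℂ. -/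
open Complex

lemma aux_integral_abs_sin : ∫ θ in (0:ℝ)..2 * Real.pi, |Real.sin θ| = 4 := by
  have hi : ∀ a b : ℝ, IntervalIntegrable (fun θ => |Real.sin θ|) MeasureTheory.volume a b :=
    fun a b => (Real.continuous_sin.abs).intervalIntegrable a b
  have hpi := Real.pi_pos
  rw [← intervalIntegral.integral_add_adjacent_intervals (hi 0 Real.pi) (hi Real.pi (2 * Real.pi))]
  have h1 : ∫ θ in (0:ℝ)..Real.pi, |Real.sin θ| = 2 := by
    rw [intervalIntegral.integral_congr (g := Real.sin)]
    · rw [integral_sin]; norm_num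
    · intro x hx
      rw [Set.uIcc_of_le hpi.le] at hx
      exact abs_of_nonneg (Real.sin_nonneg_of_mem_Icc hx)
  have h2 : ∫ θ in Real.pi..2 * Real.pi, |Real.sin θ| = 2 := by
    rw [intervalIntegral.integral_congr (g := fun x => - Real.sin x)]
    · rw [intervalIntegral.integral_neg, integral_sin]; norm_num
    · intro x hx
      rw [Set.uIcc_of_le (by linarith)] at hx
      apply abs_of_nonpos
      have := Real.sin_nonneg_of_mem_Icc (x := x - Real.pi) ⟨by linarith [hx.1], by linarith [hx.2]⟩
      rw [Real.sin_sub_pi] at this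
      linarith
  rw [h1, h2]; norm_num

lemma aux_upper (b : ℝ) (hb : 0 ≤ b) (g : ℂ → ℂ) (hg : Differentiable ℂ g)
    (C : ℝ) (hC : 1 ≤ C)
    (hbound : ∀ k : ℂ, ‖g k‖ ≤ C * Real.exp (2 * b * |k.im|)) (c : ℂ) (R : ℝ) (hR : 0 < R) :
    Real.circleAverage (fun z => Real.log ‖g z‖) c R ≤
      Real.log C + 2 * b * |c.im| + 4 * b / Real.pi * R := by
  have hA : AnalyticOnNhd ℂ g Set.univ := fun z _ => hg.analyticAt z
  have hint : CircleIntegrable (fun z => Real.log ‖g z‖) c R :=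
    ((hA.mono (Set.subset_univ _)).meromorphicOn (U := Metric.sphere c |R|)).circleIntegrable_log_norm
  have hpi := Real.pi_pos
  have key : ∫ θ in (0:ℝ)..2 * Real.pi, Real.log ‖g (circleMap c R θ)‖ ≤
      ∫ θ in (0:ℝ)..2 * Real.pi, ((Real.log C + 2 * b * |c.im|) + (2 * b * R) * |Real.sin θ|) := by
    apply intervalIntegral.integral_mono_on (by positivity) hint
    · exact Continuous.intervalIntegrable (by fun_prop) _ _
    · intro θ _
      set z := circleMap c R θ with hz
      have him : |z.im| ≤ |c.im| + R * |Real.sin θ| := by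
        have : z.im = c.im + R * Real.sin θ := by
          simp [hz, circleMap, Complex.exp_ofReal_mul_I_im]
        rw [this]
        refine (abs_add_le _ _).trans ?_
        rw [abs_mul, abs_of_pos hR]
      have h0 : Real.log ‖g z‖ ≤ Real.log C + 2 * b * |z.im| := by
        rcases eq_or_ne (g z) 0 with h | h
        · simp only [h, norm_zero, Real.log_zero]
          have := Real.log_nonneg hC
          positivity
        · have := Real.log_le_log (norm_pos_iff.mpr h) (hbound z)
          rwa [Real.log_mul (by positivity) (Real.exp_pos _).ne', Real.log_exp] at this
      have := mul_le_mul_of_nonneg_left him (by positivity : 0 ≤ 2 * b)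
      linarith
  rw [intervalIntegral.integral_add (by simp) (Continuous.intervalIntegrable (by fun_prop) _ _),
    intervalIntegral.integral_const, intervalIntegral.integral_const_mul, aux_integral_abs_sin] at key
  rw [Real.circleAverage_def, smul_eq_mul, inv_mul_le_iff₀ (by positivity)]
  refine key.trans (le_of_eq ?_)
  simp only [smul_eq_mul]
  field_simp
  ring

lemma aux_log (R0 R x : ℝ) (hR0 : 0 < R0) (hR : R0 ≤ R) (hx : 0 < x) (hxR : x ≤ R) :
    IntervalIntegrable (fun t : ℝ => if x ≤ t then t⁻¹ else 0) MeasureTheory.volume R0 R ∧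
    ∫ t in R0..R, (if x ≤ t then t⁻¹ else 0) ≤ Real.log (R * x⁻¹) := by
  have hi : ∀ u v : ℝ, 0 < u → u ≤ v →
      IntervalIntegrable (fun t : ℝ => t⁻¹) MeasureTheory.volume u v := fun u v hu huv =>
    intervalIntegral.intervalIntegrable_inv (fun t ht => by
      rw [Set.uIcc_of_le huv] at ht; linarith [ht.1]) continuousOn_id
  have hrep : (fun t : ℝ => if x ≤ t then t⁻¹ else 0) = Set.indicator (Set.Ici x) (fun t => t⁻¹) := by
    ext t; simp [Set.indicator]
  have hmeas : MeasurableSet (Set.Ici x) := measurableSet_Ici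
  have h1 : IntervalIntegrable (fun t : ℝ => if x ≤ t then t⁻¹ else 0) MeasureTheory.volume R0 R := by
    have := hi R0 R hR0 hR
    rw [intervalIntegrable_iff] at this ⊢
    rw [hrep]
    exact this.indicator hmeas
  refine ⟨h1, ?_⟩
  rcases le_total x R0 with h | h
  · rw [intervalIntegral.integral_congr (g := fun t => t⁻¹), integral_inv_of_pos hR0 (by linarith)]
    · have hRp : 0 < R := by linarith
      apply Real.log_le_log (by positivity)
      rw [div_eq_mul_inv]; gcongr
    · intro t ht
      rw [Set.uIcc_of_le hR] at ht
      have : x ≤ t := by linarith [ht.1]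
      simp [this]
  · have hsub : ∀ u v, R0 ≤ u → u ≤ v → v ≤ R →
      IntervalIntegrable (fun t : ℝ => if x ≤ t then t⁻¹ else 0) MeasureTheory.volume u v := by
      intro u v h1' h2 h3
      refine h1.mono_set ?_
      rw [Set.uIcc_of_le h2, Set.uIcc_of_le hR]
      exact Set.Icc_subset_Icc h1' h3
    rw [← intervalIntegral.integral_add_adjacent_intervals (hsub R0 x le_rfl h hxR) (hsub x R h hxR le_rfl)]
    have e2 : ∫ t in x..R, (if x ≤ t then t⁻¹ else 0) = Real.log (R * x⁻¹) := by
      rw [intervalIntegral.integral_congr (g := fun t => t⁻¹), integral_inv_of_pos hx (by linarith),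
        div_eq_mul_inv]
      intro t ht
      rw [Set.uIcc_of_le hxR] at ht
      simp [ht.1]
    have e1 : ∫ t in R0..x, (if x ≤ t then t⁻¹ else 0) = 0 := by
      apply intervalIntegral.integral_zero_ae
      filter_upwards [MeasureTheory.Measure.ae_ne MeasureTheory.volume x] with t ht ht2
      rw [Set.uIoc_of_le h] at ht2
      have : ¬ x ≤ t := not_le.mpr (lt_of_le_of_ne ht2.2 ht)
      simp [this]
    rw [e1, e2, zero_add]

lemma aux_sum (S : Finset ℂ) (c : ℂ) (A R0 R : ℝ) (hR0 : 0 < R0) (hR : R0 ≤ R)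
    (hS : ∀ u ∈ S, u ≠ c ∧ ‖c - u‖ ≤ R)
    (hcount : ∀ t ∈ Set.Icc R0 R, A * t ≤ ((S.filter (fun u => ‖c - u‖ ≤ t)).card : ℝ)) :
    A * (R - R0) ≤ ∑ u ∈ S, Real.log (R * ‖c - u‖⁻¹) := by
  have hl := fun u (hu : u ∈ S) => aux_log R0 R ‖c - u‖ hR0 hR
    (norm_pos_iff.mpr (sub_ne_zero.mpr (hS u hu).1.symm)) (hS u hu).2
  refine le_trans ?_ (Finset.sum_le_sum fun u hu => (hl u hu).2)
  rw [← intervalIntegral.integral_finsetSum (fun u hu => (hl u hu).1)]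
  have : A * (R - R0) = ∫ t in R0..R, A := by simp [mul_comm]
  rw [this]
  apply intervalIntegral.integral_mono_on hR (by simp)
  · have := IntervalIntegrable.sum S (fun u hu => (hl u hu).1)
    refine this.congr (fun t _ => ?_)
    simp
  · intro t ht
    have ht0 : 0 < t := by linarith [ht.1]
    rw [← Finset.sum_filter, Finset.sum_const, nsmul_eq_mul, ← div_eq_mul_inv, le_div_iff₀ ht0]
    exact hcount t ht

theorem entire_type_many_zeros_vanishing
    (b : ℝ) (hb : 0 ≤ b) (g : ℂ → ℂ) (hg : Differentiable ℂ g)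
    (C : ℝ) (hC : 0 < C)
    (hbound : ∀ k : ℂ, ‖g k‖ ≤ C * Real.exp (2 * b * |k.im|))
    (σ : ℝ) (hσ : b < σ)
    (hzeros : ((4 * σ / Real.pi : ℝ) : EReal) ≤
      Filter.liminf (fun r : ℝ =>
        ((({k : ℂ | ‖k‖ ≤ r ∧ g k = 0}.ncard : ℝ) / r : ℝ) : EReal)) Filter.atTop) :
    ∀ k : ℂ, g k = 0 := by
  by_contra! hne
  obtain ⟨c, hc⟩ := hne
  have hA : AnalyticOnNhd ℂ g Set.univ := fun z _ => hg.analyticAt z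
  have hpi := Real.pi_pos
  -- constants
  obtain ⟨A', hA'1, hA'2⟩ := exists_between (show 4 * b / Real.pi < 4 * σ / Real.pi by gcongr)
  obtain ⟨A, hA1, hA2⟩ := exists_between hA'1
  have hApos : 0 ≤ 4 * b / Real.pi := by positivity
  have hev := Filter.eventually_lt_of_lt_liminf (lt_of_lt_of_le (EReal.coe_lt_coe_iff.mpr hA'2) hzeros)
  obtain ⟨r0, hr0⟩ := Filter.eventually_atTop.mp hev
  -- radius from which the shifted count is at least `A t`
  obtain ⟨R0, hR0pos, hR0a, hR0b⟩ : ∃ R0 : ℝ, 0 < R0 ∧ r0 + ‖c‖ + 1 + ‖c‖ ≤ R0 ∧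
      A' * ‖c‖ ≤ (A' - A) * R0 := by
    refine ⟨max (max 1 (r0 + ‖c‖ + 1 + ‖c‖)) (A' * ‖c‖ / (A' - A)), by positivity, ?_, ?_⟩
    · exact (le_max_right _ _).trans (le_max_left _ _)
    · rw [mul_comm (A' - A), ← div_le_iff₀ (by linarith)]
      exact le_max_right _ _
  obtain ⟨R1, hR1pos, hR1a⟩ : ∃ R1 : ℝ, 0 < R1 ∧ 2 * ‖c‖ ≤ R1 := ⟨2 * ‖c‖ + 1, by positivity, by linarith⟩
  set R2 := max R0 R1
  have hmain : ∀ R, R2 ≤ R → A * (R - R2) + Real.log ‖g c‖ ≤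
      Real.log (max C 1) + 2 * b * |c.im| + 4 * b / Real.pi * R := by
    intro R hR
    have hR2 : R0 ≤ R2 := le_max_left _ _
    have hRpos : 0 < R := by linarith
    have hAR : AnalyticOnNhd ℂ g (Metric.closedBall c |R|) := hA.mono (Set.subset_univ _)
    have hJ := hAR.circleAverage_log_norm hRpos.ne' hc
    have hU := aux_upper b hb g hg (max C 1) (le_max_right _ _)
      (fun k => (hbound k).trans (by gcongr; exact le_max_left _ _)) c R hRpos
    set D := MeromorphicOn.divisor g (Metric.closedBall c |R|) with hD
    have hfin := D.finiteSupport (isCompact_closedBall c |R|)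
    have hmem : ∀ u, g u = 0 → ‖c - u‖ ≤ R → 1 ≤ D u := by
      intro u hu hu2
      have hub : u ∈ Metric.closedBall c |R| := by
        rw [Metric.mem_closedBall, dist_comm, dist_eq_norm, abs_of_pos hRpos]; exact hu2
      rw [hD, MeromorphicOn.AnalyticOnNhd.divisor_apply hAR hub]
      have h1 : analyticOrderAt g u ≠ 0 := by
        rw [(hAR u hub).analyticOrderAt_ne_zero]; exact hu
      have h2 : analyticOrderAt g u ≠ ⊤ := by
        intro h
        rw [analyticOrderAt_eq_top] at h
        exact hc (hA.eqOn_zero_of_preconnected_of_eventuallyEq_zero isPreconnected_univ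
          (Set.mem_univ u) h (Set.mem_univ c))
      obtain ⟨n, hn⟩ := ENat.ne_top_iff_exists.mp h2
      rw [← hn] at h1 ⊢
      have h3 : n ≠ 0 := by exact_mod_cast h1
      simp only [ENat.map_natCast, WithTop.untop₀_coe]
      omega
    have hDnn : ∀ u, 0 ≤ D u := fun u => MeromorphicOn.AnalyticOnNhd.divisor_nonneg hAR u
    have hsupp : ∀ u ∈ hfin.toFinset, u ≠ c ∧ ‖c - u‖ ≤ R := by
      intro u hu
      have hu0 : D u ≠ 0 := by simpa using hu
      have hub : u ∈ Metric.closedBall c |R| := by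
        by_contra h
        exact hu0 (D.apply_eq_zero_of_notMem h)
      refine ⟨?_, ?_⟩
      · rintro rfl
        apply hu0
        rw [hD, MeromorphicOn.AnalyticOnNhd.divisor_apply hAR hub, (hAR u hub).analyticOrderAt_eq_zero.mpr hc]
        simp
      · rwa [Metric.mem_closedBall, dist_comm, dist_eq_norm, abs_of_pos hRpos] at hub
    have hS := aux_sum hfin.toFinset c A R2 R (by linarith) hR hsupp (by
      intro t ht
      have htr := hr0 (t - ‖c‖) (by linarith [ht.1, norm_nonneg c])
      rw [EReal.coe_lt_coe_iff] at htr
      have htp : 0 < t - ‖c‖ := by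
        have := le_max_right R0 R1
        have h2 := ht.1
        have h3 := norm_nonneg c
        change R1 ≤ R2 at this
        linarith
      rw [lt_div_iff₀ htp] at htr
      have hsub : ({k : ℂ | ‖k‖ ≤ t - ‖c‖ ∧ g k = 0}) ⊆
          ((hfin.toFinset.filter (fun u => ‖c - u‖ ≤ t) : Finset ℂ) : Set ℂ) := by
        rintro k ⟨hk1, hk2⟩
        have hk3 : ‖c - k‖ ≤ t := by linarith [norm_sub_le c k]
        have := hmem k hk2 (hk3.trans ht.2)
        have h5 : D k ≠ 0 := by omega
        simpa [hk3] using h5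
      have hcard := Set.ncard_le_ncard hsub (Finset.finite_toSet _)
      rw [Set.ncard_coe_finset] at hcard
      have hcard' : (({k : ℂ | ‖k‖ ≤ t - ‖c‖ ∧ g k = 0}).ncard : ℝ) ≤
        ((hfin.toFinset.filter (fun u => ‖c - u‖ ≤ t)).card : ℝ) := by exact_mod_cast hcard
      refine le_trans ?_ hcard'
      have : (A' - A) * R0 ≤ (A' - A) * t :=
        mul_le_mul_of_nonneg_left (hR2.trans ht.1) (by linarith)
      nlinarith)
    rw [finsum_eq_sum_of_support_subset (s := hfin.toFinset) _ (by
      intro u hu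
      simp only [Function.mem_support] at hu
      have : D u ≠ 0 := by
        intro h; apply hu; simp [h]
      simpa using this)] at hJ
    have hle : ∑ u ∈ hfin.toFinset, Real.log (R * ‖c - u‖⁻¹) ≤
        ∑ u ∈ hfin.toFinset, (D u : ℝ) * Real.log (R * ‖c - u‖⁻¹) := by
      apply Finset.sum_le_sum
      intro u hu
      have h1 : (1:ℝ) ≤ D u := by
        have : D u ≠ 0 := by simpa using hu
        have h2 := hDnn u
        have : 1 ≤ D u := by omega
        exact_mod_cast this
      obtain ⟨h3, h4⟩ := hsupp u hu
      have h5 : 0 < ‖c - u‖ := norm_pos_iff.mpr (sub_ne_zero.mpr h3.symm)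
      have : 0 ≤ Real.log (R * ‖c - u‖⁻¹) := by
        apply Real.log_nonneg
        rw [← div_eq_mul_inv, le_div_iff₀ h5]; linarith
      nlinarith
    linarith
  -- contradiction for large R
  set K := Real.log (max C 1) + 2 * b * |c.im| + A * R2 - Real.log ‖g c‖ with hK
  have hpos : 0 < A - 4 * b / Real.pi := by linarith
  have h := hmain (max R2 ((K + 1) / (A - 4 * b / Real.pi))) (le_max_left _ _)
  have h2 := le_max_right R2 ((K + 1) / (A - 4 * b / Real.pi))
  rw [div_le_iff₀ hpos] at h2
  nlinarith
end
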